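/- There is a universal constant C > 0 such that the following holds. Let X = {1,...,m} with the usual total order, m ≥ 2, let ℓ : [0,1]×[0,1] → ℝ≥0 be an L-Lipschitz loss function, let n ≥ 2 and ε ∈ (0,1]. Then there exists a randomized algorithm M mapping each dataset D ∈ (X×[0,1])^n to a probability distribution over functions f : X → [0,1] that are monotone and convex (meaning f(x+1) − f(x) is non-decreasing in x for 1 ≤ x ≤ m−1), such that M is ε-differentially private and for every dataset D, E_{f∼M(D)}[L_ℓ(f;D)] − min over monotone convex g : X → [0,1] of L_ℓ(g;D) is at most C · L · log(nm) · (1 + log²(εn)) / (εn). -/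

import Mathlib

open MeasureTheory

noncomputable section

/-- The (normalized) empirical risk of `f` on dataset `D` with loss `ℓ`. -/
def empRisk {X : Type*} (ℓ : ℝ → ℝ → ℝ) {n : ℕ} (f : X → ℝ) (D : Fin n → X × ℝ) : ℝ :=
  (1 / (n : ℝ)) * ∑ i, ℓ (f (D i).1) (D i).2

/-- A valid dataset: all labels lie in `[0,1]`. -/
def IsDataset {X : Type*} {n : ℕ} (D : Fin n → X × ℝ) : Prop :=
  ∀ i, (D i).2 ∈ Set.Icc (0 : ℝ) 1

/-- Two (valid) datasets are neighboring if they differ in at most one entry. -/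
def NeighborDS {X : Type*} {n : ℕ} (D D' : Fin n → X × ℝ) : Prop :=
  IsDataset D ∧ IsDataset D' ∧ ∃ i, ∀ j, j ≠ i → D j = D' j

/-- A monotone function on the poset `X` taking values in `[0,1]`. -/
def IsMonotone01 {X : Type*} [PartialOrder X] (f : X → ℝ) : Prop :=
  Monotone f ∧ ∀ x, f x ∈ Set.Icc (0 : ℝ) 1

/-- The optimal empirical risk over all monotone `[0,1]`-valued functions. -/
def optRisk {X : Type*} [PartialOrder X] (ℓ : ℝ → ℝ → ℝ) {n : ℕ} (D : Fin n → X × ℝ) : ℝ :=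
  ⨅ g : {g : X → ℝ // IsMonotone01 g}, empRisk ℓ g.1 D

/-- `(ε, δ)`-differential privacy of a mechanism `M` w.r.t. a neighboring relation. -/
def IsDP {I Ω : Type*} [MeasurableSpace Ω] (Neighbor : I → I → Prop)
    (M : I → Measure Ω) (ε δ : ℝ) : Prop :=
  ∀ D D', Neighbor D D' → ∀ S : Set Ω, MeasurableSet S →
    M D S ≤ ENNReal.ofReal (Real.exp ε) * M D' S + ENNReal.ofReal δ

/-- A loss function `ℓ : [0,1] × [0,1] → ℝ≥0` that is `L`-Lipschitz in its first argument. -/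
def IsLipschitzLoss (ℓ : ℝ → ℝ → ℝ) (L : ℝ) : Prop :=
  (∀ y z : ℝ, y ∈ Set.Icc (0:ℝ) 1 → z ∈ Set.Icc (0:ℝ) 1 → 0 ≤ ℓ y z) ∧
  (∀ y y' z : ℝ, y ∈ Set.Icc (0:ℝ) 1 → y' ∈ Set.Icc (0:ℝ) 1 → z ∈ Set.Icc (0:ℝ) 1 →
    |ℓ y z - ℓ y' z| ≤ L * |y - y'|)

/-- An `R`-distance-based loss function: `ℓ(y,y') = g(|y - y'|)` for a non-decreasing
nonnegative `g` with `g 0 = 0` and `g (1/2) ≥ R`. -/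
def IsDistanceBasedLoss (ℓ : ℝ → ℝ → ℝ) (R : ℝ) : Prop :=
  ∃ g : ℝ → ℝ, MonotoneOn g (Set.Icc (0:ℝ) 1) ∧ (∀ t ∈ Set.Icc (0:ℝ) 1, 0 ≤ g t) ∧
    g 0 = 0 ∧ R ≤ g (1 / 2) ∧
    ∀ y y' : ℝ, y ∈ Set.Icc (0:ℝ) 1 → y' ∈ Set.Icc (0:ℝ) 1 → ℓ y y' = g |y - y'|

/-- The width of a poset: the largest size of an antichain. -/
def posetWidth (X : Type*) [PartialOrder X] : ℕ :=
  sSup {k | ∃ A : Finset X, IsAntichain (· ≤ ·) (A : Set X) ∧ A.card = k}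

/-- An isotonic-regression mechanism: on each valid dataset it outputs a probability
distribution supported on monotone `[0,1]`-valued functions. -/
def IsIsoRegAlg {X : Type*} [PartialOrder X] {n : ℕ}
    (M : (Fin n → X × ℝ) → Measure (X → ℝ)) : Prop :=
  ∀ D : Fin n → X × ℝ, IsDataset D →
    IsProbabilityMeasure (M D) ∧ M D {f | IsMonotone01 f} = 1

/-- `f : {1,…,m} → ℝ` is convex over the discrete domain: `f(x+2) + f(x) ≥ 2·f(x+1)`,
i.e., the discrete derivative `f(x+1) − f(x)` is non-decreasing. -/
def DiscreteConvex {m : ℕ} (f : Fin m → ℝ) : Prop :=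
  ∀ x : ℕ, ∀ h : x + 2 < m,
    2 * f ⟨x + 1, by omega⟩ ≤ f ⟨x + 2, h⟩ + f ⟨x, by omega⟩

open Real Finset

/-- The Gibbs weights of a score `q` on a finite set `S` at inverse temperature `β`. -/
def gibbsWeight {κ : Type*} (S : Finset κ) (β : ℝ) (q : κ → ℝ) (k : κ) : ℝ :=
  exp (-(β * q k)) / ∑ j ∈ S, exp (-(β * q j))

lemma gibbsWeight_nonneg {κ : Type*} (S : Finset κ) (β : ℝ) (q : κ → ℝ) (k : κ) :
    0 ≤ gibbsWeight S β q k := by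
  unfold gibbsWeight; positivity

lemma sum_gibbsWeight {κ : Type*} {S : Finset κ} (hS : S.Nonempty) (β : ℝ) (q : κ → ℝ) :
    ∑ k ∈ S, gibbsWeight S β q k = 1 := by
  have hZ : 0 < ∑ j ∈ S, exp (-(β * q j)) := sum_pos (fun _ _ => exp_pos _) hS
  unfold gibbsWeight
  rw [← sum_div, div_self hZ.ne']

lemma gibbsWeight_le_exp_mul {κ : Type*} {S : Finset κ} {β Δ c : ℝ} (hβ : 0 ≤ β)
    {q q' : κ → ℝ} (h : ∀ k ∈ S, |q k - q' k - c| ≤ Δ) {k : κ} (hk : k ∈ S) :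
    gibbsWeight S β q k ≤ exp (2 * β * Δ) * gibbsWeight S β q' k := by
  have hZ : 0 < ∑ j ∈ S, exp (-(β * q j)) := sum_pos (fun _ _ => exp_pos _) ⟨k, hk⟩
  have hZ' : 0 < ∑ j ∈ S, exp (-(β * q' j)) := sum_pos (fun _ _ => exp_pos _) ⟨k, hk⟩
  have h1 : exp (-(β * q k)) ≤ exp (β * (Δ - c)) * exp (-(β * q' k)) := by
    rw [← exp_add]
    apply exp_le_exp.2
    nlinarith [mul_le_mul_of_nonneg_left (abs_le.1 (h k hk)).1 hβ]
  have h2 : ∑ j ∈ S, exp (-(β * q' j)) ≤ exp (β * (Δ + c)) * ∑ j ∈ S, exp (-(β * q j)) := by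
    rw [mul_sum]
    refine sum_le_sum fun j hj => ?_
    rw [← exp_add]
    apply exp_le_exp.2
    nlinarith [mul_le_mul_of_nonneg_left (abs_le.1 (h j hj)).2 hβ]
  unfold gibbsWeight
  rw [← mul_div_assoc, div_le_div_iff₀ hZ hZ']
  calc exp (-(β * q k)) * ∑ j ∈ S, exp (-(β * q' j))
      ≤ (exp (β * (Δ - c)) * exp (-(β * q' k))) *
          (exp (β * (Δ + c)) * ∑ j ∈ S, exp (-(β * q j))) := by gcongr
    _ = (exp (β * (Δ - c)) * exp (β * (Δ + c))) * exp (-(β * q' k)) *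
          ∑ j ∈ S, exp (-(β * q j)) := by ring
    _ = exp (2 * β * Δ) * exp (-(β * q' k)) * ∑ j ∈ S, exp (-(β * q j)) := by
        rw [← exp_add]; ring_nf

lemma sum_gibbsWeight_mul_le {κ : Type*} {S : Finset κ} {β : ℝ} (hβ : 0 < β)
    (q : κ → ℝ) {k : κ} (hk : k ∈ S) :
    ∑ j ∈ S, gibbsWeight S β q j * q j ≤ q k + (log #S + 1) / β := by
  have hcard : (0 : ℝ) < #S := by exact_mod_cast card_pos.2 ⟨k, hk⟩
  have hZ : 0 < ∑ j ∈ S, exp (-(β * q j)) := sum_pos (fun _ _ => exp_pos _) ⟨k, hk⟩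
  have key : ∀ j ∈ S, exp (-(β * q j)) * (β * q j - β * q k - log #S)
      ≤ exp (-(β * q k)) / #S := by
    intro j _
    set t := β * q j - β * q k - log #S with ht
    have hexp : exp (-(β * q j)) = exp (-t) * (exp (-(β * q k)) / #S) := by
      have : -(β * q j) = -t + (-(β * q k) - log #S) := by rw [ht]; ring
      rw [this, exp_add, exp_sub, exp_log hcard]
    have h1 : exp (-t) * t ≤ 1 := by
      have h2 : t ≤ exp t := by linarith [add_one_le_exp t]
      calc exp (-t) * t ≤ exp (-t) * exp t := by gcongr
        _ = 1 := by rw [← exp_add]; simp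
    rw [hexp]
    calc exp (-t) * (exp (-(β * q k)) / #S) * t
        = (exp (-t) * t) * (exp (-(β * q k)) / #S) := by ring
      _ ≤ 1 * (exp (-(β * q k)) / #S) := by gcongr
      _ = _ := one_mul _
  have hsum := sum_le_sum key
  rw [sum_const, nsmul_eq_mul, mul_div_cancel₀ _ hcard.ne'] at hsum
  have hle : exp (-(β * q k)) ≤ ∑ j ∈ S, exp (-(β * q j)) :=
    single_le_sum (f := fun j => exp (-(β * q j))) (fun _ _ => (exp_pos _).le) hk
  have hexpand : ∑ j ∈ S, exp (-(β * q j)) * (β * q j - β * q k - log #S)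
      = β * ∑ j ∈ S, exp (-(β * q j)) * q j
        - (β * q k + log #S) * ∑ j ∈ S, exp (-(β * q j)) := by
    rw [mul_sum, mul_sum, ← sum_sub_distrib]
    exact sum_congr rfl fun _ _ => by ring
  have hsum' : ∑ j ∈ S, gibbsWeight S β q j * q j
      = (∑ j ∈ S, exp (-(β * q j)) * q j) / ∑ j ∈ S, exp (-(β * q j)) := by
    rw [sum_div]
    exact sum_congr rfl fun _ _ => by unfold gibbsWeight; ring
  rw [hsum', div_le_iff₀ hZ]
  have : q k + (log #S + 1) / β = (β * q k + log #S + 1) / β := by field_simp; ring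
  rw [this, div_mul_eq_mul_div, le_div_iff₀ hβ]
  nlinarith

lemma abs_ciInf_sub_ciInf_sub_le {ι : Type*} [Nonempty ι] {φ ψ : ι → ℝ} {c Δ : ℝ}
    (hφ : BddBelow (Set.range φ)) (hψ : BddBelow (Set.range ψ))
    (h : ∀ i, |φ i - ψ i - c| ≤ Δ) : |(⨅ i, φ i) - (⨅ i, ψ i) - c| ≤ Δ := by
  have h1 : (⨅ i, φ i) - c - Δ ≤ ⨅ i, ψ i := le_ciInf fun i => by
    linarith [ciInf_le hφ i, (abs_le.1 (h i)).2]
  have h2 : (⨅ i, ψ i) + c - Δ ≤ ⨅ i, φ i := le_ciInf fun i => by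
    linarith [ciInf_le hψ i, (abs_le.1 (h i)).1]
  exact abs_le.2 ⟨by linarith, by linarith⟩

/-- The sizes of the sublevel sets of `g` at the levels `1/r, 2/r, …, r/r`. -/
def levelCode {m : ℕ} (r : ℕ) (g : Fin m → ℝ) (j : Fin r) : Fin (m + 1) :=
  ⟨#{x | r * g x < (j : ℝ) + 1}, Nat.lt_succ_of_le ((card_le_univ _).trans_eq (by simp))⟩

lemma lt_iff_lt_of_levelCode_eq {m r : ℕ} {g g' : Fin m → ℝ} (hg : Monotone g)
    (hg' : Monotone g') (h : levelCode r g = levelCode r g') (j : Fin r) (x : Fin m) :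
    r * g x < (j : ℝ) + 1 ↔ r * g' x < (j : ℝ) + 1 := by
  have hc : #{x | r * g x < (j : ℝ) + 1} = #{x | r * g' x < (j : ℝ) + 1} := by
    simpa [levelCode] using congrArg Fin.val (congrFun h j)
  have lower : ∀ f : Fin m → ℝ, Monotone f → IsLowerSet {x | r * f x < (j : ℝ) + 1} :=
    fun f hf a b hba ha =>
      lt_of_le_of_lt (mul_le_mul_of_nonneg_left (hf hba) (Nat.cast_nonneg r)) ha
  have heq : univ.filter (fun x => r * g x < (j : ℝ) + 1)
      = univ.filter (fun x => r * g' x < (j : ℝ) + 1) := by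
    rcases (lower g hg).total (lower g' hg') with hs | hs
    · exact eq_of_subset_of_card_le (fun y hy => by
        simpa using hs (show y ∈ _ by simpa using hy)) hc.ge
    · exact (eq_of_subset_of_card_le (fun y hy => by
        simpa using hs (show y ∈ _ by simpa using hy)) hc.le).symm
  simpa using Finset.ext_iff.1 heq x

lemma abs_sub_le_of_levelCode_eq {m r : ℕ} (hr : 0 < r) {g g' : Fin m → ℝ}
    (hg : IsMonotone01 g) (hg' : IsMonotone01 g') (h : levelCode r g = levelCode r g')
    (x : Fin m) : |g x - g' x| ≤ 1 / r := by
  have main : ∀ f f' : Fin m → ℝ, IsMonotone01 f → IsMonotone01 f' →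
      levelCode r f = levelCode r f' → r * f x - r * f' x ≤ 1 := by
    intro f f' hf hf' hff
    have h0 : 0 ≤ r * f' x := mul_nonneg (Nat.cast_nonneg r) (hf'.2 x).1
    by_cases hlt : ⌊r * f' x⌋₊ < r
    · have := (lt_iff_lt_of_levelCode_eq hf.1 hf'.1 hff ⟨_, hlt⟩ x).2 (Nat.lt_floor_add_one _)
      have h2 := Nat.floor_le h0
      simp only at this
      linarith
    · have h1 : (r : ℝ) ≤ r * f' x :=
        (Nat.cast_le.2 (not_lt.1 hlt)).trans (Nat.floor_le h0)
      nlinarith [(hf.2 x).2, (Nat.cast_nonneg r : (0 : ℝ) ≤ r)]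
  have hr' : (0 : ℝ) < r := Nat.cast_pos.2 hr
  rw [abs_sub_le_iff, le_div_iff₀ hr', le_div_iff₀ hr']
  constructor <;> linarith [main g g' hg hg' h, main g' g hg' hg h.symm]

/-- The total loss of `f` on `D`. -/
def totalLoss {X : Type*} (ℓ : ℝ → ℝ → ℝ) {n : ℕ} (f : X → ℝ) (D : Fin n → X × ℝ) : ℝ :=
  ∑ i, ℓ (f (D i).1) (D i).2

lemma IsLipschitzLoss.totalLoss_sub_le {X : Type*} [PartialOrder X] {ℓ : ℝ → ℝ → ℝ} {L : ℝ}
    (hℓ : IsLipschitzLoss ℓ L) (hL : 0 ≤ L) {n : ℕ} {D : Fin n → X × ℝ} (hD : IsDataset D)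
    {f g : X → ℝ} (hf : IsMonotone01 f) (hg : IsMonotone01 g) {d : ℝ}
    (hd : ∀ x, |f x - g x| ≤ d) : totalLoss ℓ f D - totalLoss ℓ g D ≤ n * (L * d) := by
  unfold totalLoss
  rw [← sum_sub_distrib]
  calc _ ≤ ∑ _i : Fin n, L * d := sum_le_sum fun i _ =>
        (le_abs_self _).trans ((hℓ.2 _ _ _ (hf.2 _) (hg.2 _) (hD i)).trans (by gcongr; exact hd _))
    _ = n * (L * d) := by simp

lemma IsLipschitzLoss.totalLoss_nonneg {X : Type*} [PartialOrder X] {ℓ : ℝ → ℝ → ℝ} {L : ℝ}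
    (hℓ : IsLipschitzLoss ℓ L) {n : ℕ} {D : Fin n → X × ℝ} (hD : IsDataset D)
    {f : X → ℝ} (hf : IsMonotone01 f) : 0 ≤ totalLoss ℓ f D :=
  sum_nonneg fun i _ => hℓ.1 _ _ (hf.2 _) (hD i)

lemma IsLipschitzLoss.abs_totalLoss_sub_le {X : Type*} [PartialOrder X] {ℓ : ℝ → ℝ → ℝ}
    {L : ℝ} (hℓ : IsLipschitzLoss ℓ L) (hL : 0 ≤ L) {n : ℕ} {D D' : Fin n → X × ℝ}
    (hN : NeighborDS D D') {f g : X → ℝ} (hf : IsMonotone01 f) (hg : IsMonotone01 g) {d : ℝ}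
    (hd : ∀ x, |f x - g x| ≤ d) :
    |totalLoss ℓ f D - totalLoss ℓ f D' - (totalLoss ℓ g D - totalLoss ℓ g D')|
      ≤ 2 * (L * d) := by
  obtain ⟨hD, hD', i, hi⟩ := hN
  have hbound : ∀ E : Fin n → X × ℝ, IsDataset E →
      |ℓ (f (E i).1) (E i).2 - ℓ (g (E i).1) (E i).2| ≤ L * d := fun E hE =>
    (hℓ.2 _ _ _ (hf.2 _) (hg.2 _) (hE i)).trans (by gcongr; exact hd _)
  have hsplit : ∀ h : X → ℝ, totalLoss ℓ h D - totalLoss ℓ h D'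
      = ℓ (h (D i).1) (D i).2 - ℓ (h (D' i).1) (D' i).2 := by
    intro h
    unfold totalLoss
    rw [← sum_sub_distrib]
    exact sum_eq_single i (fun j _ hj => by rw [hi j hj, sub_self]) (by simp)
  rw [hsplit, hsplit]
  have h1 := abs_le.1 (hbound D hD)
  have h2 := abs_le.1 (hbound D' hD')
  exact abs_le.2 ⟨by linarith, by linarith⟩

/-- A mechanism with outputs in `A`, whose output laws integrate every function, which is
`ε`-differentially private and has expected total loss within `err` of the best in `A`. -/
structure IsPrivateSelector {X : Type*} {n : ℕ} (ℓ : ℝ → ℝ → ℝ) (A : Set (X → ℝ))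
    (ε err : ℝ) (M : (Fin n → X × ℝ) → Measure (X → ℝ)) : Prop where
  prob : ∀ D, IsProbabilityMeasure (M D)
  supp : ∀ D, M D A = 1
  integrable : ∀ D, ∀ φ : (X → ℝ) → ℝ, Integrable φ (M D)
  dp : ∀ D D', NeighborDS D D' → ∀ S, M D S ≤ ENNReal.ofReal (exp ε) * M D' S
  loss_le : ∀ D, IsDataset D → ∀ g ∈ A, ∫ f, totalLoss ℓ f D ∂(M D) ≤ totalLoss ℓ g D + err

lemma exists_isPrivateSelector_const {m n : ℕ} {ℓ : ℝ → ℝ → ℝ} {L : ℝ}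
    (hℓ : IsLipschitzLoss ℓ L) (hL : 0 ≤ L) {A : Set (Fin m → ℝ)} (hA : A.Nonempty)
    (hA01 : ∀ f ∈ A, IsMonotone01 f) {d : ℝ} (hd : ∀ f ∈ A, ∀ g ∈ A, ∀ x, |f x - g x| ≤ d) :
    ∃ M : (Fin n → Fin m × ℝ) → Measure (Fin m → ℝ),
      IsPrivateSelector ℓ A 0 (n * (L * d)) M := by
  obtain ⟨a, ha⟩ := hA
  refine ⟨fun _ => Measure.dirac a, fun _ => inferInstance, fun _ =>
    Measure.dirac_apply_of_mem ha, fun _ φ => integrable_dirac (by simp), fun _ _ _ S => by simp,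
    fun D hD g hg => ?_⟩
  rw [integral_dirac]
  linarith [hℓ.totalLoss_sub_le hL hD (hA01 a ha) (hA01 g hg) (hd a ha g hg)]

/-- Selecting a fibre of `code` by the exponential mechanism and then running a private selector
inside that fibre. -/
lemma exists_isPrivateSelector_of_fibers {m n : ℕ} {ℓ : ℝ → ℝ → ℝ} {L : ℝ}
    (hℓ : IsLipschitzLoss ℓ L) (hL : 0 < L) {A : Set (Fin m → ℝ)} (hA : A.Nonempty)
    (hA01 : ∀ f ∈ A, IsMonotone01 f) {d : ℝ} (hd0 : 0 < d)
    (hd : ∀ f ∈ A, ∀ g ∈ A, ∀ x, |f x - g x| ≤ d)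
    {κ : Type*} [Fintype κ] (code : (Fin m → ℝ) → κ) {ε ε' err : ℝ} (hε : 0 < ε)
    (hfib : ∀ k, (A ∩ code ⁻¹' {k}).Nonempty →
      ∃ M : (Fin n → Fin m × ℝ) → Measure (Fin m → ℝ),
        IsPrivateSelector ℓ (A ∩ code ⁻¹' {k}) ε' err M) :
    ∃ M : (Fin n → Fin m × ℝ) → Measure (Fin m → ℝ),
      IsPrivateSelector ℓ A (ε + ε')
        ((log (Fintype.card κ) + 1) * (4 * (L * d)) / ε + err) M := by
  classical
  set B : κ → Set (Fin m → ℝ) := fun k => A ∩ code ⁻¹' {k}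
  set S : Finset κ := {k | (B k).Nonempty} with hS
  have memS : ∀ k, k ∈ S ↔ (B k).Nonempty := fun k => by simp [hS]
  have hSne : S.Nonempty := by
    obtain ⟨a, ha⟩ := hA
    exact ⟨code a, (memS _).2 ⟨a, ha, rfl⟩⟩
  choose! N hN using hfib
  have hN' : ∀ k ∈ S, IsPrivateSelector ℓ (B k) ε' err (N k) := fun k hk =>
    hN k ((memS k).1 hk)
  set q : (Fin n → Fin m × ℝ) → κ → ℝ := fun D k => ⨅ g : B k, totalLoss ℓ g.1 D
  set β : ℝ := ε / (4 * (L * d)) with hβ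
  have hβ0 : 0 < β := by positivity
  have bdd : ∀ D : Fin n → Fin m × ℝ, IsDataset D → ∀ k,
      BddBelow (Set.range fun g : B k => totalLoss ℓ g.1 D) := by
    intro D hD k
    refine ⟨0, ?_⟩
    rintro _ ⟨g, rfl⟩
    exact hℓ.totalLoss_nonneg hD (hA01 _ g.2.1)
  have hint : ∀ D, ∀ φ : (Fin m → ℝ) → ℝ, ∀ k ∈ S,
      Integrable φ (ENNReal.ofReal (gibbsWeight S β (q D) k) • N k D) := fun D φ k hk =>
    ((hN' k hk).integrable D φ).smul_measure ENNReal.ofReal_ne_top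
  have hmass : ∀ D, ∀ T : Set (Fin m → ℝ), (∀ k ∈ S, N k D T = 1) →
      (∑ k ∈ S, ENNReal.ofReal (gibbsWeight S β (q D) k) • N k D) T = 1 := by
    intro D T hT
    rw [Measure.finsetSum_apply]
    calc _ = ∑ k ∈ S, ENNReal.ofReal (gibbsWeight S β (q D) k) :=
          sum_congr rfl fun k hk => by simp [hT k hk]
      _ = ENNReal.ofReal (∑ k ∈ S, gibbsWeight S β (q D) k) :=
          (ENNReal.ofReal_sum_of_nonneg fun _ _ => gibbsWeight_nonneg _ _ _ _).symm
      _ = 1 := by rw [sum_gibbsWeight hSne]; simp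
  refine ⟨fun D => ∑ k ∈ S, ENNReal.ofReal (gibbsWeight S β (q D) k) • N k D,
    fun D => ⟨hmass D _ fun k hk => ((hN' k hk).prob D).measure_univ⟩,
    fun D => hmass D _ fun k hk => ?_, fun D φ => ?_, fun D D' hDD T => ?_,
    fun D hD g hg => ?_⟩
  · have := (hN' k hk).prob D
    exact le_antisymm prob_le_one
      (((hN' k hk).supp D).symm.le.trans (measure_mono Set.inter_subset_left))
  · exact integrable_finsetSum_measure.2 (hint D φ)
  · obtain ⟨a, ha⟩ := hA
    have hsens : ∀ k ∈ S, |q D k - q D' k - (totalLoss ℓ a D - totalLoss ℓ a D')|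
        ≤ 2 * (L * d) := by
      intro k hk
      have : Nonempty (B k) := ((memS k).1 hk).to_subtype
      exact abs_ciInf_sub_ciInf_sub_le (bdd D hDD.1 k) (bdd D' hDD.2.1 k) fun g =>
        hℓ.abs_totalLoss_sub_le hL.le hDD (hA01 _ g.2.1) (hA01 a ha) (hd _ g.2.1 a ha)
    have hεβ : 2 * β * (2 * (L * d)) = ε := by rw [hβ]; field_simp; ring
    simp only [Measure.finsetSum_apply, Measure.smul_apply, smul_eq_mul]
    rw [mul_sum]
    refine sum_le_sum fun k hk => ?_
    have hw := gibbsWeight_le_exp_mul hβ0.le hsens hk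
    rw [hεβ] at hw
    calc ENNReal.ofReal (gibbsWeight S β (q D) k) * N k D T
        ≤ ENNReal.ofReal (exp ε * gibbsWeight S β (q D') k) *
            (ENNReal.ofReal (exp ε') * N k D' T) :=
          mul_le_mul' (ENNReal.ofReal_le_ofReal hw) ((hN' k hk).dp D D' hDD T)
      _ = ENNReal.ofReal (exp (ε + ε')) *
            (ENNReal.ofReal (gibbsWeight S β (q D') k) * N k D' T) := by
          rw [exp_add, ENNReal.ofReal_mul (exp_pos _).le, ENNReal.ofReal_mul (exp_pos _).le]
          ring
  · rw [integral_finsetSum_measure (hint D _)]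
    simp only [integral_smul_measure, smul_eq_mul,
      ENNReal.toReal_ofReal (gibbsWeight_nonneg _ _ _ _)]
    have hk : code g ∈ S := (memS _).2 ⟨g, hg, rfl⟩
    have hqg : q D (code g) ≤ totalLoss ℓ g D :=
      ciInf_le (bdd D hD (code g)) ⟨g, hg, rfl⟩
    have hcard : log #S ≤ log (Fintype.card κ) :=
      log_le_log (by exact_mod_cast card_pos.2 hSne) (by exact_mod_cast card_le_univ S)
    calc ∑ k ∈ S, gibbsWeight S β (q D) k * ∫ f, totalLoss ℓ f D ∂(N k D)
        ≤ ∑ k ∈ S, gibbsWeight S β (q D) k * (q D k + err) := by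
          refine sum_le_sum fun k hk =>
            mul_le_mul_of_nonneg_left ?_ (gibbsWeight_nonneg _ _ _ _)
          have : Nonempty (B k) := ((memS k).1 hk).to_subtype
          rw [← sub_le_iff_le_add]
          exact le_ciInf fun g => by linarith [(hN' k hk).loss_le D hD g.1 g.2]
      _ = ∑ k ∈ S, gibbsWeight S β (q D) k * q D k + err := by
          simp only [mul_add, sum_add_distrib]
          rw [← sum_mul, sum_gibbsWeight hSne, one_mul]
      _ ≤ q D (code g) + (log #S + 1) / β + err := by
          gcongr; exact sum_gibbsWeight_mul_le hβ0 _ hk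
      _ ≤ totalLoss ℓ g D + (log (Fintype.card κ) + 1) / β + err := by gcongr
      _ = _ := by rw [hβ, div_div_eq_mul_div, add_assoc]

/-- Iterated refinement: `s` rounds, each halving the sup-norm diameter of the current cell. -/
lemma exists_isPrivateSelector_chain {m n : ℕ} (hm : 2 ≤ m) {ℓ : ℝ → ℝ → ℝ} {L : ℝ}
    (hℓ : IsLipschitzLoss ℓ L) (hL : 0 < L) {ε : ℝ} (hε : 0 < ε) (s : ℕ) :
    ∀ (i : ℕ) (A : Set (Fin m → ℝ)), A.Nonempty → (∀ f ∈ A, IsMonotone01 f) →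
      (∀ f ∈ A, ∀ g ∈ A, ∀ x, |f x - g x| ≤ 1 / 2 ^ i) →
      ∃ M : (Fin n → Fin m × ℝ) → Measure (Fin m → ℝ),
        IsPrivateSelector ℓ A (s * ε)
          (s * (12 * L * log (m + 1) / ε) + n * (L * (1 / 2 ^ (i + s)))) M := by
  induction s with
  | zero =>
    intro i A hA hA01 hd
    simpa using exists_isPrivateSelector_const hℓ hL.le hA hA01 hd
  | succ s ih =>
    intro i A hA hA01 hd
    obtain ⟨M, hM⟩ := exists_isPrivateSelector_of_fibers (n := n) hℓ hL hA hA01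
      (by positivity) hd (levelCode (2 ^ (i + 1))) hε fun k hk =>
        ih (i + 1) _ hk (fun f hf => hA01 f hf.1) fun f hf g hg x => by
          simpa using abs_sub_le_of_levelCode_eq (by positivity) (hA01 f hf.1) (hA01 g hg.1)
            (hf.2.trans hg.2.symm) x
    have hlog : 1 ≤ log ((m : ℝ) + 1) := by
      rw [le_log_iff_exp_le (by positivity)]
      have : (2 : ℝ) ≤ m := by exact_mod_cast hm
      linarith [exp_one_lt_d9]
    have hcost : (log (Fintype.card (Fin (2 ^ (i + 1)) → Fin (m + 1))) + 1) *
        (4 * (L * (1 / 2 ^ i))) / ε ≤ 12 * L * log (m + 1) / ε := by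
      refine div_le_div_of_nonneg_right ?_ hε.le
      simp only [Fintype.card_fun, Fintype.card_fin]
      push_cast
      rw [log_pow]
      push_cast
      have h2 : (1 : ℝ) / 2 ^ i ≤ 1 :=
        (div_le_one (by positivity)).2 (one_le_pow₀ (by norm_num))
      calc (2 ^ (i + 1) * log ((m : ℝ) + 1) + 1) * (4 * (L * (1 / 2 ^ i)))
          = 8 * L * log (m + 1) + 4 * L * (1 / 2 ^ i) := by field_simp; ring
        _ ≤ 8 * L * log (m + 1) + 4 * L * log (m + 1) := by gcongr; linarith
        _ = _ := by ring
    refine ⟨M, hM.prob, hM.supp, hM.integrable, ?_, fun D hD g hg => ?_⟩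
    · have : ((s + 1 : ℕ) : ℝ) * ε = ε + s * ε := by push_cast; ring
      rw [this]
      exact hM.dp
    · refine (hM.loss_le D hD g hg).trans ?_
      rw [show i + 1 + s = i + (s + 1) by ring]
      push_cast
      linarith

lemma ceil_log_div_log_two_sq_le {x : ℝ} (hx : 1 < x) :
    (⌈log x / log 2⌉₊ : ℝ) ^ 2 ≤ 5 * (1 + log x ^ 2) := by
  have h2 : (2 / 3 : ℝ) < log 2 := by linarith [log_two_gt_d9]
  have hlx : 0 < log x := log_pos hx
  have h1 : (⌈log x / log 2⌉₊ : ℝ) < log x / log 2 + 1 := Nat.ceil_lt_add_one (by positivity)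
  have h3 : log x / log 2 ≤ 3 / 2 * log x := by
    rw [div_le_iff₀ (by linarith)]; nlinarith
  have h4 : (⌈log x / log 2⌉₊ : ℝ) ≤ 3 / 2 * log x + 1 := by linarith
  calc (⌈log x / log 2⌉₊ : ℝ) ^ 2 ≤ (3 / 2 * log x + 1) ^ 2 := by gcongr
    _ ≤ 5 * (1 + log x ^ 2) := by nlinarith [sq_nonneg (log x - 1)]

lemma le_two_pow_ceil_log_div_log_two {x : ℝ} (hx : 0 < x) :
    x ≤ 2 ^ ⌈log x / log 2⌉₊ := by
  have h2 : 0 < log 2 := log_pos one_lt_two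
  rw [← log_le_log_iff hx (by positivity), log_pow, ← div_le_iff₀ h2]
  exact Nat.le_ceil _

/-- **Convex isotonic regression (Theorem 5, convex case).** There is a universal
constant `C > 0` such that for `X = {1,…,m}` (here `Fin m`) with `m ≥ 2`, any
`L`-Lipschitz loss `ℓ`, any `n ≥ 2` and `ε ∈ (0,1]`, there is an `ε`-DP mechanism
outputting monotone convex functions whose expected excess empirical risk relative to
the best monotone convex function is at most `C · L · log(nm) · (1 + log²(εn)) / (εn)`. -/
theorem dp_convex_isotonic_regression_upper_bound :
    ∃ C : ℝ, 0 < C ∧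
      ∀ m : ℕ, 2 ≤ m →
        ∀ (ℓ : ℝ → ℝ → ℝ) (L : ℝ), IsLipschitzLoss ℓ L →
        ∀ n : ℕ, 2 ≤ n →
        ∀ ε : ℝ, ε ∈ Set.Ioc (0 : ℝ) 1 →
        ∃ M : (Fin n → Fin m × ℝ) → Measure (Fin m → ℝ),
          (∀ D : Fin n → Fin m × ℝ, IsDataset D →
            IsProbabilityMeasure (M D) ∧
              M D {f | IsMonotone01 f ∧ DiscreteConvex f} = 1) ∧
          IsDP NeighborDS M ε 0 ∧
          ∀ D : Fin n → Fin m × ℝ, IsDataset D →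
            (∫ f, empRisk ℓ f D ∂(M D)) -
              (⨅ g : {g : Fin m → ℝ // IsMonotone01 g ∧ DiscreteConvex g},
                empRisk ℓ g.1 D) ≤
              C * L * Real.log ((n : ℝ) * m) * (1 + Real.log (ε * n) ^ 2) / (ε * n) := by
  refine ⟨61, by norm_num, fun m hm ℓ L hℓ n hn ε hε => ?_⟩
  obtain ⟨hε0, hε1⟩ := hε
  have hL : 0 ≤ L := by
    have := hℓ.2 1 0 0 (by simp) (by simp) (by simp)
    simp only [sub_zero, abs_one, mul_one] at this
    exact (abs_nonneg _).trans this
  have hn2 : (2 : ℝ) ≤ n := by exact_mod_cast hn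
  have hm2 : (2 : ℝ) ≤ m := by exact_mod_cast hm
  have hn0 : (0 : ℝ) < n := by linarith
  have hx0 : 0 < ε * n := by positivity
  set A : Set (Fin m → ℝ) := {f | IsMonotone01 f ∧ DiscreteConvex f}
  have hA : A.Nonempty := ⟨fun _ => 0, ⟨fun _ _ _ => le_rfl, fun _ => by simp⟩, fun _ _ => by simp⟩
  have hA01 : ∀ f ∈ A, IsMonotone01 f := fun f hf => hf.1
  have hd : ∀ f ∈ A, ∀ g ∈ A, ∀ x, |f x - g x| ≤ 1 := fun f hf g hg x =>
    abs_le.2 ⟨by linarith [(hf.1.2 x).1, (hg.1.2 x).2], by linarith [(hf.1.2 x).2, (hg.1.2 x).1]⟩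
  have hlogm : log ((m : ℝ) + 1) ≤ log (n * m) := log_le_log (by positivity) (by nlinarith)
  have hlog1 : 1 ≤ log ((n : ℝ) * m) := by
    rw [le_log_iff_exp_le (by positivity)]
    nlinarith [exp_one_lt_d9]
  suffices h : ∃ (err : ℝ) (M : (Fin n → Fin m × ℝ) → Measure (Fin m → ℝ)),
      IsPrivateSelector ℓ A ε err M ∧
      err ≤ 61 * L * log (n * m) * (1 + log (ε * n) ^ 2) / ε by
    obtain ⟨err, M, hM, herr⟩ := h
    refine ⟨M, fun D _ => ⟨hM.prob D, hM.supp D⟩, fun D D' hDD S _ => ?_, fun D hD => ?_⟩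
    · simpa using hM.dp D D' hDD S
    · have hne : Nonempty {g : Fin m → ℝ // IsMonotone01 g ∧ DiscreteConvex g} :=
        hA.to_subtype
      rw [sub_le_iff_le_add', ← sub_le_iff_le_add]
      refine le_ciInf fun g => ?_
      have hint : ∫ f, empRisk ℓ f D ∂(M D) = 1 / n * ∫ f, totalLoss ℓ f D ∂(M D) :=
        integral_const_mul _ _
      have hg : empRisk ℓ g.1 D = 1 / n * totalLoss ℓ g.1 D := rfl
      have hle := hM.loss_le D hD g.1 g.2
      rw [hint, hg, sub_le_iff_le_add]
      calc 1 / (n : ℝ) * ∫ f, totalLoss ℓ f D ∂(M D)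
          ≤ 1 / n * (totalLoss ℓ g.1 D +
              61 * L * log (n * m) * (1 + log (ε * n) ^ 2) / ε) := by gcongr; linarith
        _ = _ := by field_simp
  by_cases htriv : L = 0 ∨ ε * n ≤ 1
  · obtain ⟨M, hM⟩ := exists_isPrivateSelector_const (n := n) hℓ hL hA hA01 hd
    refine ⟨_, M, ⟨hM.prob, hM.supp, hM.integrable, fun D D' hDD S => ?_, hM.loss_le⟩, ?_⟩
    · exact (hM.dp D D' hDD S).trans (by gcongr)
    · rcases htriv with rfl | hx
      · simp
      · rw [le_div_iff₀ hε0]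
        have h1 : 1 ≤ log (n * m) * (1 + log (ε * n) ^ 2) := by
          nlinarith [sq_nonneg (log (ε * n))]
        nlinarith [mul_le_mul_of_nonneg_left hx hL, mul_le_mul_of_nonneg_left h1 hL]
  · push Not at htriv
    obtain ⟨hL0, hx⟩ := htriv
    have hLpos : 0 < L := lt_of_le_of_ne hL (Ne.symm hL0)
    set T := ⌈log (ε * n) / log 2⌉₊
    have hT0 : 0 < T := Nat.ceil_pos.2 (div_pos (log_pos hx) (log_pos one_lt_two))
    have hT0' : (0 : ℝ) < T := Nat.cast_pos.2 hT0
    have hTsq : (T : ℝ) ^ 2 ≤ 5 * (1 + log (ε * n) ^ 2) := ceil_log_div_log_two_sq_le hx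
    have hpow : ε * n ≤ 2 ^ T := le_two_pow_ceil_log_div_log_two hx0
    obtain ⟨M, hM⟩ := exists_isPrivateSelector_chain (n := n) hm hℓ hLpos
      (div_pos hε0 hT0') T 0 A hA hA01 (by simpa using hd)
    rw [mul_div_cancel₀ _ hT0'.ne'] at hM
    refine ⟨_, M, hM, ?_⟩
    have h1 : (n : ℝ) * (L * (1 / 2 ^ (0 + T))) ≤ L * log (n * m) * (1 + log (ε * n) ^ 2) / ε := by
      rw [zero_add, le_div_iff₀ hε0]
      have h3 : (n : ℝ) * (L * (1 / 2 ^ T)) * ε = L * (ε * n / 2 ^ T) := by ring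
      have h4 : ε * n / 2 ^ T ≤ 1 := (div_le_one (by positivity)).2 hpow
      have h5 : 1 ≤ log (n * m) * (1 + log (ε * n) ^ 2) := by
        nlinarith [sq_nonneg (log (ε * n))]
      rw [h3, mul_assoc]
      exact mul_le_mul_of_nonneg_left (h4.trans h5) hL
    have h2 : (T : ℝ) * (12 * L * log (m + 1) / (ε / T))
        ≤ 60 * (L * log (n * m) * (1 + log (ε * n) ^ 2) / ε) := by
      calc (T : ℝ) * (12 * L * log (m + 1) / (ε / T))
          = 12 * L * log (m + 1) * T ^ 2 / ε := by field_simp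
        _ ≤ 12 * L * log (n * m) * (5 * (1 + log (ε * n) ^ 2)) / ε := by gcongr
        _ = _ := by ring
    calc _ ≤ 60 * (L * log (n * m) * (1 + log (ε * n) ^ 2) / ε)
          + L * log (n * m) * (1 + log (ε * n) ^ 2) / ε := add_le_add h2 h1
      _ = _ := by ring
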